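/- Let N ≥ 1 and let y be a nonzero complex number. Then Σ_{k=0}^{⌊N/2⌋} (-1)^k · (1/(N-k)) · binom(N-k, k) · (y + y⁻¹)^{N-2k} = (y^N + y^{-N})/N. (This identifies the coefficient A_N of -log(1 - χ·t + t²) with (α^N + β^N)/N, where α, β are the two roots of the quadratic, i.e., α = y, β = y⁻¹ with α + β = χ and αβ = 1.) -/

import Mathlib

section SecondKind

variable {R : Type*} [CommRing R]

/-- The rescaled Chebyshev polynomial of the second kind, as an explicit sum. The terms with
`n < 2 * k` vanish. -/
def secondKindSum (x : R) (n : ℕ) : R :=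
  ∑ k ∈ Finset.range (n + 1), (-1) ^ k * ((n - k).choose k : R) * x ^ (n - 2 * k)

theorem secondKindSum_succ (x : R) (n : ℕ) :
    secondKindSum x (n + 1) = x ^ (n + 1) +
      ∑ k ∈ Finset.range (n + 1),
        (-1) ^ (k + 1) * ((n - k).choose (k + 1) : R) * x ^ (n + 1 - 2 * (k + 1)) := by
  rw [secondKindSum, Finset.sum_range_succ']
  simp [add_comm]

theorem secondKindSum_add_two_eq_sum (x : R) (n : ℕ) :
    secondKindSum x (n + 2) = x ^ (n + 2) +
      ∑ k ∈ Finset.range (n + 1),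
        (-1) ^ (k + 1) * ((n + 1 - k).choose (k + 1) : R) * x ^ (n - 2 * k) := by
  rw [secondKindSum_succ, Finset.sum_range_succ]
  simp [show ∀ k, n + 2 - 2 * (k + 1) = n - 2 * k by omega]

theorem secondKindSum_add_two (x : R) (n : ℕ) :
    secondKindSum x (n + 2) = x * secondKindSum x (n + 1) - secondKindSum x n := by
  rw [secondKindSum_add_two_eq_sum, secondKindSum_succ, secondKindSum, mul_add, Finset.mul_sum,
    add_sub_assoc, ← Finset.sum_sub_distrib, ← pow_succ']
  congr 1
  refine Finset.sum_congr rfl fun k hk => ?_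
  have hkn : k ≤ n := Finset.mem_range_succ_iff.mp hk
  rw [Nat.sub_add_comm hkn, Nat.choose_succ_succ]
  push_cast
  rcases le_or_gt (k + 1) (n - k) with h | h
  · rw [show n - 2 * k = n + 1 - 2 * (k + 1) + 1 by omega]
    ring
  · rw [Nat.choose_eq_zero_of_lt h]
    push_cast
    ring

theorem secondKindSum_sub_of_mul_eq_one {a b : R} (hab : a * b = 1) (n : ℕ) :
    secondKindSum (a + b) (n + 2) - secondKindSum (a + b) n = a ^ (n + 2) + b ^ (n + 2) := by
  induction n using Nat.twoStepInduction with
  | zero =>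
    simp [secondKindSum, Finset.sum_range_succ]
    linear_combination 2 * hab
  | one =>
    simp [secondKindSum, Finset.sum_range_succ]
    linear_combination 3 * (a + b) * hab
  | more n h₀ h₁ =>
    rw [secondKindSum_add_two _ (n + 2)]
    linear_combination (a + b) * h₁ - h₀ - secondKindSum_add_two (a + b) n +
      (a ^ (n + 2) + b ^ (n + 2)) * hab

end SecondKind

theorem add_two_mul_sum_choose_div {K : Type*} [Field K] [CharZero K] (x : K) (n : ℕ) :
    ((n + 2 : ℕ) : K) * ∑ k ∈ Finset.range ((n + 2) / 2 + 1),
        (-1 : K) ^ k * (1 / ((n + 2 - k : ℕ) : K)) * (((n + 2 - k).choose k : ℕ) : K) *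
          x ^ (n + 2 - 2 * k) =
      secondKindSum x (n + 2) - secondKindSum x n := by
  have hsub : Finset.range ((n + 2) / 2 + 1) ⊆ Finset.range (n + 2) :=
    Finset.range_subset_range.mpr (by omega)
  rw [Finset.sum_subset hsub fun k _ hk => by
      rw [Finset.mem_range] at hk
      rw [Nat.choose_eq_zero_of_lt (by omega : n + 2 - k < k)]
      simp,
    Finset.sum_range_succ', mul_add, add_comm (_ * _), secondKindSum_add_two_eq_sum, secondKindSum,
    add_sub_assoc, ← Finset.sum_sub_distrib, Finset.mul_sum]
  congr 1
  · have : ((n + 2 : ℕ) : K) ≠ 0 := Nat.cast_ne_zero.mpr (by omega)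
    simp only [pow_zero, Nat.sub_zero, Nat.choose_zero_right, mul_zero, Nat.cast_one]
    field_simp
  refine Finset.sum_congr rfl fun k hk => ?_
  obtain ⟨m, rfl⟩ := Nat.exists_eq_add_of_le (Finset.mem_range_succ_iff.mp hk)
  have hm : (m : K) + 1 ≠ 0 := Nat.cast_add_one_ne_zero m
  have hc : ((m : K) + 1) * (m.choose k : K) = ((m + 1).choose (k + 1) : K) * ((k : K) + 1) := by
    exact_mod_cast Nat.add_one_mul_choose_eq m k
  rw [show k + m + 2 - (k + 1) = m + 1 by omega, show k + m + 1 - k = m + 1 by omega,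
    show k + m - k = m by omega, show k + m + 2 - 2 * (k + 1) = k + m - 2 * k by omega]
  push_cast
  field_simp
  linear_combination (-1) ^ k * x ^ (k + m - 2 * k) * hc


/-- Identification of the coefficient `A_N` of `-log(1 - χ·t + t²)` at `χ = y + y⁻¹` with
`(y^N + y^{-N})/N`: the two roots of the quadratic are `y` and `y⁻¹`. -/
theorem logCoeff_eval_add_inv (N : ℕ) (hN : 1 ≤ N) (y : ℂ) (hy : y ≠ 0) :
    ∑ k ∈ Finset.range (N / 2 + 1),
        (-1 : ℂ) ^ k * (1 / ((N - k : ℕ) : ℂ)) * (((N - k).choose k : ℕ) : ℂ) *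
          (y + y⁻¹) ^ (N - 2 * k) =
      (y ^ N + (y⁻¹) ^ N) / (N : ℂ) := by
 
  obtain rfl | ⟨n, rfl⟩ : N = 1 ∨ ∃ n, N = n + 2 := by
    rcases hN.eq_or_lt with h | h
    · exact Or.inl h.symm
    · exact Or.inr (Nat.exists_eq_add_of_le' h)
  · simp
  · rw [eq_div_iff (Nat.cast_ne_zero.mpr (by omega)), mul_comm, add_two_mul_sum_choose_div,
      secondKindSum_sub_of_mul_eq_one (mul_inv_cancel₀ hy)]
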